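/- There exists p₀ such that for every prime p ≥ p₀ the following holds: for any u, w ∈ V₁, the number of triples (e₁, e₂, e₃) of pairwise distinct edges of H for which there exist vertices v₂ ∈ V₂ and v₃ ∈ V₃ with u, v₂, v₃, w pairwise distinct such that {u,v₂} ⊆ e₁, {v₂,v₃} ⊆ e₂, and {v₃,w} ⊆ e₃ is at most 108. (That is, there are at most 108 Berge 3-paths of type (1,2,3,1) with end vertices u and w.) -/

import Mathlib

/-- The conditions required of the set `S₁ ⊆ F_p`. -/
def S1Cond (p : ℕ) (S1 : Set (ZMod p)) : Prop :=
  ∀ x ∈ S1,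
    (2 ≤ x.val ∧ x.val ≤ (p - 1) / 2) ∧
    (∀ w : ZMod p, x ≠ -w ^ 2) ∧
    x ^ 2 - 4 * x + 1 ≠ 0 ∧
    3 * x ≠ 1 ∧ 3 * x ≠ 2 ∧
    10872 * x ^ 5 - 12757 * x ^ 4 + 3369 * x ^ 3 + 2312 * x ^ 2
      - 1176 * x - 144 ≠ 0

/-- `S₂ = F_p \ {0, 1}`. -/
def S2set (p : ℕ) : Set (ZMod p) := {x | x ≠ 0 ∧ x ≠ 1}

/-- The part `V_i = S₁ × S₂ × S₂ × {i}` of the vertex set. -/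
def Vpart (p : ℕ) (S1 : Set (ZMod p)) (i : ℕ) : Set (ZMod p × ZMod p × ZMod p × ℕ) :=
  {v | v.1 ∈ S1 ∧ v.2.1 ∈ S2set p ∧ v.2.2.1 ∈ S2set p ∧ v.2.2.2 = i}

/-- The triple `e(x₁, x₂, x₃, a)`. -/
def hedge (p : ℕ) (x1 x2 x3 a : ZMod p) : Set (ZMod p × ZMod p × ZMod p × ℕ) :=
  {(x1, x2 * x3 + a, x2 ^ 2 * x3 + a, 1),
   (x2, x3 * x1 + a, x3 ^ 2 * x1 + a, 2),
   (x3, x1 * x2 + a, x1 ^ 2 * x2 + a, 3)}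

/-- The edge set of the hypergraph `H`. -/
def Hedges (p : ℕ) (S1 : Set (ZMod p)) : Set (Set (ZMod p × ZMod p × ZMod p × ℕ)) :=
  {E | ∃ x1 x2 x3 a : ZMod p, x1 ∈ S1 ∧ x2 ∈ S1 ∧ x3 ∈ S1 ∧ a ≠ 0 ∧
    E = hedge p x1 x2 x3 a ∧
    E ⊆ Vpart p S1 1 ∪ Vpart p S1 2 ∪ Vpart p S1 3}

section Elimination

open Polynomial

theorem coeff_prod_sum_of_natDegree_le {R ι : Type*} [CommRing R] (s : Finset ι) (f : ι → R[X])
    (c : ι → ℕ) (h : ∀ i ∈ s, (f i).natDegree ≤ c i) :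
    (∏ i ∈ s, f i).coeff (∑ i ∈ s, c i) = ∏ i ∈ s, (f i).coeff (c i) := by
  classical
  induction s using Finset.induction_on with
  | empty => simp
  | insert a s ha ih =>
    have hs : ∀ i ∈ s, (f i).natDegree ≤ c i := fun i hi => h i (Finset.mem_insert_of_mem hi)
    rw [Finset.prod_insert ha, Finset.sum_insert ha, Finset.prod_insert ha,
      coeff_mul_add_eq_of_natDegree_le (h a (Finset.mem_insert_self a s))
        ((natDegree_prod_le _ _).trans (Finset.sum_le_sum hs)), ih hs]

theorem coeff_det_sum_of_natDegree_le {R ι : Type*} [CommRing R] [Fintype ι] [DecidableEq ι]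
    (M : Matrix ι ι R[X]) (c : ι → ℕ) (h : ∀ i j, (M i j).natDegree ≤ c j) :
    M.det.coeff (∑ j, c j) = (Matrix.of fun i j => (M i j).coeff (c j)).det := by
  simp only [Matrix.det_apply, finsetSum_coeff, coeff_smul, Matrix.of_apply]
  exact Finset.sum_congr rfl fun σ _ => by
    rw [coeff_prod_sum_of_natDegree_le _ _ _ fun i _ => h (σ i) i]

theorem natDegree_det_le_sum {R ι : Type*} [CommRing R] [Fintype ι] [DecidableEq ι]
    (M : Matrix ι ι R[X]) (c : ι → ℕ) (h : ∀ i j, (M i j).natDegree ≤ c j) :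
    M.det.natDegree ≤ ∑ j, c j := by
  rw [Matrix.det_apply]
  refine natDegree_sum_le_of_forall_le _ _ fun σ _ => ?_
  refine (natDegree_smul_le _ _).trans ((natDegree_prod_le _ _).trans ?_)
  exact Finset.sum_le_sum fun i _ => h (σ i) i

/-- A row permutation of the Sylvester matrix of a quartic and a cubic. -/
def sylvesterQuarticCubic {R : Type*} [Zero R] (p0 p1 p2 p3 p4 q0 q1 q2 q3 : R) :
    Matrix (Fin 7) (Fin 7) R :=
  !![q0, q1, q2, q3, 0, 0, 0;
     0, q0, q1, q2, q3, 0, 0;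
     p0, p1, p2, p3, p4, 0, 0;
     0, p0, p1, p2, p3, p4, 0;
     0, 0, p0, p1, p2, p3, p4;
     0, 0, q0, q1, q2, q3, 0;
     0, 0, 0, q0, q1, q2, q3]

theorem det_sylvesterQuarticCubic_eq_zero {F : Type*} [Field F]
    {p0 p1 p2 p3 p4 q0 q1 q2 q3 n : F}
    (hp : p0 + p1 * n + p2 * n ^ 2 + p3 * n ^ 3 + p4 * n ^ 4 = 0)
    (hq : q0 + q1 * n + q2 * n ^ 2 + q3 * n ^ 3 = 0) :
    (sylvesterQuarticCubic p0 p1 p2 p3 p4 q0 q1 q2 q3).det = 0 := by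
  refine Matrix.exists_mulVec_eq_zero_iff.mp ⟨fun j => n ^ (j : ℕ), fun h => ?_, ?_⟩
  · simpa using congrFun h 0
  · ext i
    fin_cases i <;>
      simp [sylvesterQuarticCubic, Matrix.mulVec, dotProduct, Fin.sum_univ_succ, Fin.succ]
    · linear_combination hq
    · linear_combination n * hq
    · linear_combination hp
    · linear_combination n * hp
    · linear_combination n ^ 2 * hp
    · linear_combination n ^ 2 * hq
    · linear_combination n ^ 3 * hq

theorem det_sylvesterQuarticCubic_ne_zero {F : Type*} [Field F]
    {p0 p1 p2 p3 p4 q0 q1 q2 q3 : F[X]}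
    (hp0 : p0.natDegree ≤ 1) (hp1 : p1.natDegree ≤ 4) (hp2 : p2.natDegree ≤ 7)
    (hp3 : p3.natDegree ≤ 5) (hp4 : p4.natDegree ≤ 6)
    (hq0 : q0.natDegree ≤ 3) (hq1 : q1.natDegree ≤ 4) (hq2 : q2.natDegree ≤ 4)
    (hq3 : q3.natDegree ≤ 4)
    (cp2 : p2.coeff 7 ≠ 0) (cq0 : q0.coeff 3 ≠ 0) (cq3 : q3.coeff 4 ≠ 0) :
    (sylvesterQuarticCubic p0 p1 p2 p3 p4 q0 q1 q2 q3).det ≠ 0 ∧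
      (sylvesterQuarticCubic p0 p1 p2 p3 p4 q0 q1 q2 q3).det.natDegree ≤ 35 := by
  set M := sylvesterQuarticCubic p0 p1 p2 p3 p4 q0 q1 q2 q3
  let r : Fin 7 → ℕ := ![0, 2, 0, 0, 0, 3, 3]
  let c : Fin 7 → ℕ := ![3, 5, 7, 7, 7, 7, 7]
  let N : Matrix (Fin 7) (Fin 7) F[X] := Matrix.of fun i j => X ^ r i * M i j
  have hN : N.det = X ^ 8 * M.det := by
    rw [Matrix.det_mul_column, Finset.prod_pow_eq_pow_sum]
    rfl
  have hdeg : ∀ i j, (N i j).natDegree ≤ c j := by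
    intro i j
    refine (natDegree_mul_le (p := X ^ r i) (q := M i j)).trans ?_
    rw [natDegree_X_pow]
    fin_cases i <;> fin_cases j <;> simp [M, sylvesterQuarticCubic, r, c] <;> omega
  have hcoeff : N.det.coeff 43 ≠ 0 := by
    have h := coeff_det_sum_of_natDegree_le N c hdeg
    have hc : ∑ j, c j = 43 := rfl
    rw [hc] at h
    rw [h, Matrix.det_of_isLowerTriangular]
    · rw [Finset.prod_ne_zero_iff]
      intro i _
      fin_cases i <;>
        simp [N, M, sylvesterQuarticCubic, r, c, coeff_X_pow_mul', cp2, cq0, cq3]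
    · intro i j hij
      have hij' : i < j := hij
      refine coeff_eq_zero_of_natDegree_lt (p := N i j) ?_
      refine (natDegree_mul_le (p := X ^ r i) (q := M i j)).trans_lt ?_
      rw [natDegree_X_pow]
      revert hij'
      fin_cases i <;> fin_cases j <;> simp [M, sylvesterQuarticCubic, r, c] <;> omega
  have h0 : M.det ≠ 0 := by
    rintro h
    simp [hN, h] at hcoeff
  refine ⟨h0, ?_⟩
  have h := natDegree_det_le_sum N c hdeg
  have hc : ∑ j, c j = 43 := rfl
  rw [hN, natDegree_X_pow_mul _ h0, hc] at h
  omega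

theorem map_det_sylvesterQuarticCubic {R S : Type*} [CommRing R] [CommRing S] (φ : R →+* S)
    (p0 p1 p2 p3 p4 q0 q1 q2 q3 : R) :
    φ (sylvesterQuarticCubic p0 p1 p2 p3 p4 q0 q1 q2 q3).det =
      (sylvesterQuarticCubic (φ p0) (φ p1) (φ p2) (φ p3) (φ p4)
        (φ q0) (φ q1) (φ q2) (φ q3)).det := by
  rw [RingHom.map_det]
  congr 1
  ext i j
  fin_cases i <;> fin_cases j <;> simp [sylvesterQuarticCubic]

/-- If a quartic and a cubic whose coefficients are polynomials in a parameter have a Sylvester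
determinant of degree at most `35`, they have at most `108` common zeros, provided the cubic
degenerates for at most two parameters and the quartic never does. -/
theorem exists_finset_common_zeros {F : Type*} [Field F]
    {p0 p1 p2 p3 p4 q0 q1 q2 q3 e : F[X]} {v : F → Prop}
    (hR : (sylvesterQuarticCubic p0 p1 p2 p3 p4 q0 q1 q2 q3).det ≠ 0)
    (hdeg : (sylvesterQuarticCubic p0 p1 p2 p3 p4 q0 q1 q2 q3).det.natDegree ≤ 35)
    (he : e ≠ 0) (hedeg : e.natDegree ≤ 2) (hv : ∀ k, v k → p0.eval k ≠ 0)
    (hqe : ∀ k, v k → q3.eval k = 0 → e.eval k = 0) :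
    ∃ G : Finset (F × F), G.card ≤ 108 ∧ ∀ k n, v k →
      p0.eval k + p1.eval k * n + p2.eval k * n ^ 2 + p3.eval k * n ^ 3 + p4.eval k * n ^ 4 = 0 →
      q0.eval k + q1.eval k * n + q2.eval k * n ^ 2 + q3.eval k * n ^ 3 = 0 → (k, n) ∈ G := by
  classical
  set R := (sylvesterQuarticCubic p0 p1 p2 p3 p4 q0 q1 q2 q3).det
  let P : F → F[X] := fun k => C (p4.eval k) * X ^ 4 + C (p3.eval k) * X ^ 3 +
    C (p2.eval k) * X ^ 2 + C (p1.eval k) * X + C (p0.eval k)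
  let Q : F → F[X] := fun k => C (q3.eval k) * X ^ 3 + C (q2.eval k) * X ^ 2 +
    C (q1.eval k) * X + C (q0.eval k)
  let Z : F → Finset F := fun k =>
    if e.eval k = 0 then (P k).roots.toFinset else (Q k).roots.toFinset
  have hZ : ∀ k, (Z k).card ≤ 3 + if e.eval k = 0 then 1 else 0 := by
    intro k
    simp only [Z]
    split_ifs
    · exact (Multiset.toFinset_card_le _).trans ((card_roots' _).trans (by
        simp only [P]; compute_degree))
    · exact (Multiset.toFinset_card_le _).trans ((card_roots' _).trans natDegree_cubic_le)
  let S := R.roots.toFinset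
  have hS : S.card ≤ 35 := (Multiset.toFinset_card_le _).trans ((card_roots' _).trans hdeg)
  refine ⟨S.biUnion fun k => (Z k).image (Prod.mk k), ?_, ?_⟩
  · calc _ ≤ ∑ k ∈ S, ((Z k).image (Prod.mk k)).card := Finset.card_biUnion_le
      _ ≤ ∑ k ∈ S, (3 + if e.eval k = 0 then 1 else 0) :=
        Finset.sum_le_sum fun k _ => Finset.card_image_le.trans (hZ k)
      _ = S.card * 3 + (S.filter fun k => e.eval k = 0).card := by
        rw [Finset.sum_add_distrib, Finset.sum_const, Finset.card_filter, smul_eq_mul]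
      _ ≤ 35 * 3 + e.roots.toFinset.card := by
        refine Nat.add_le_add (Nat.mul_le_mul_right _ hS) (Finset.card_le_card fun k hk => ?_)
        simpa [he] using (Finset.mem_filter.mp hk).2
      _ ≤ 108 := by
        have := (Multiset.toFinset_card_le e.roots).trans ((card_roots' _).trans hedeg)
        omega
  · intro k n hk hP hQ
    simp only [Finset.mem_biUnion, Finset.mem_image, Prod.mk.injEq]
    refine ⟨k, ?_, n, ?_, rfl, rfl⟩
    · have h := map_det_sylvesterQuarticCubic (evalRingHom k) p0 p1 p2 p3 p4 q0 q1 q2 q3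
      rw [Multiset.mem_toFinset, mem_roots hR, IsRoot]
      exact h.trans (det_sylvesterQuarticCubic_eq_zero hP hQ)
    · simp only [Z]
      split_ifs with h
      · have h0 : P k ≠ 0 := fun h0 => hv k hk (by
          simpa [P] using congrArg (fun g => eval 0 g) h0)
        rw [Multiset.mem_toFinset, mem_roots h0, IsRoot]
        simp only [P, eval_add, eval_mul, eval_pow, eval_C, eval_X]
        linear_combination hP
      · have h0 : Q k ≠ 0 := fun h0 => h (hqe k hk (by
          simpa [Q, coeff_X, coeff_C] using congrArg (fun g => coeff g 3) h0))
        rw [Multiset.mem_toFinset, mem_roots h0, IsRoot]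
        simp only [Q, eval_add, eval_mul, eval_pow, eval_C, eval_X]
        linear_combination hQ
/-- Substituting `n = d f / c` and `g = d k b` turns the equations of a path into a quartic and a
cubic equation for `n`, together with linear equations for `b` and `c`. -/
theorem path_elimination {F : Type*} [Field F] {x y A B K b c d f g k n : F}
    (hx : x ≠ 0) (hA : A ≠ 0) (hB : B ≠ 0) (hc0 : c ≠ 0) (hd0 : d ≠ 0)
    (hn : n * c = d * f) (hk1 : d * k ≠ 1) (hdx : d ≠ x)
    (h1 : c * (b * (b - 1)) = A) (h2 : x * (c * (c - 1)) = d * (f * (f - 1)))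
    (h3 : g = d * k * b) (h4 : f * (g * (g - 1)) = B)
    (h5 : d * b - b * c + c * x - f * d - y * g + g * f = K) :
    d * x - n ^ 2 ≠ 0 ∧ d * k ^ 2 * A * n - B ≠ 0 ∧
    c * (d * x - n ^ 2) = d * (x - n) ∧
    b * (d * k ^ 2 * A * n - B) = k * A * n - B ∧
    d * (x - n) * (k * A * n - B) * (k * n) * (1 - d * k)
      - (d * x - n ^ 2) * (d * k ^ 2 * A * n - B) ^ 2 = 0 ∧
    d * (1 - k * y) * (k * A * n - B) * (d * x - n ^ 2)
      + d * (x - n) ^ 2 * (d * k ^ 2 * A * n - B)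
      + d * (k * A * n - B) * (x - n) * (k * n - 1)
      - K * (d * x - n ^ 2) * (d * k ^ 2 * A * n - B) = 0 := by
  have e1 : c * (d * x - n ^ 2) = d * (x - n) := by
    apply mul_left_cancel₀ hc0
    linear_combination d * h2 - (n * c + d * f - d) * hn
  have hb : b ≠ 0 := by rintro rfl; apply hA; rw [← h1]; ring
  have e2 : b * (d * k ^ 2 * A * n - B) = k * A * n - B := by
    subst h3
    have h : b * ((d * k ^ 2 * A * n - B) * b) = b * (k * A * n - B) := by
      apply mul_left_cancel₀ hc0
      linear_combination (-B) * h1 + A * h4 + A * k * b * (d * k * b - 1) * hn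
    have := mul_left_cancel₀ hb h
    linear_combination this
  have hD1 : d * x - n ^ 2 ≠ 0 := by
    intro h
    rw [h, mul_zero] at e1
    have hxn : x - n = 0 := (mul_eq_zero.mp e1.symm).resolve_left hd0
    have : x * (d - x) = 0 := by linear_combination h - (x + n) * hxn
    rcases mul_eq_zero.mp this with h | h
    · exact hx h
    · exact hdx (sub_eq_zero.mp h)
  have hD2 : d * k ^ 2 * A * n - B ≠ 0 := by
    intro h
    rw [h, mul_zero] at e2
    have : B * (d * k - 1) = 0 := by linear_combination h + d * k * e2
    rcases mul_eq_zero.mp this with h | h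
    · exact hB h
    · exact hk1 (sub_eq_zero.mp h)
  refine ⟨hD1, hD2, e1, e2, ?_, ?_⟩
  · have e3 : (b - 1) * (d * k ^ 2 * A * n - B) = k * A * n * (1 - d * k) := by
      linear_combination e2
    apply mul_left_cancel₀ hA
    generalize hE1 : d * x - n ^ 2 = E1 at *
    generalize hE2 : d * k ^ 2 * A * n - B = E2 at *
    generalize hL : k * A * n - B = L at *
    linear_combination (E1 * E2 ^ 2) * h1 - b * (b - 1) * E2 ^ 2 * e1
      - d * (x - n) * (b - 1) * E2 * e2 - d * (x - n) * L * e3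
  · subst h3
    generalize hE1 : d * x - n ^ 2 = E1 at *
    generalize hE2 : d * k ^ 2 * A * n - B = E2 at *
    generalize hL : k * A * n - B = L at *
    have h6 : d * b - b * c + c * x - n * c - y * (d * k * b) + k * b * (n * c) = K := by
      linear_combination h5 + (k * b - 1) * hn
    linear_combination E1 * E2 * h6 - (d * (1 - k * y) * E1 + c * E1 * (k * n - 1)) * e2
      - ((x - n) * E2 + L * (k * n - 1)) * e1

theorem exists_finset_path_parameters {F : Type*} [Field F] (x y A B K : F)
    (hx : x ≠ 0) (hy : y ≠ 0) (hY : y ^ 2 - y ≠ 0) (hA : A ≠ 0) (hB : B ≠ 0) :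
    ∃ G : Finset (F × F), G.card ≤ 108 ∧ ∀ k n d : F, d = 1 + (y ^ 2 - y) * k → d ≠ 0 → k ≠ 0 →
      d * (x - n) * (k * A * n - B) * (k * n) * (1 - d * k)
        - (d * x - n ^ 2) * (d * k ^ 2 * A * n - B) ^ 2 = 0 →
      d * (1 - k * y) * (k * A * n - B) * (d * x - n ^ 2)
        + d * (x - n) ^ 2 * (d * k ^ 2 * A * n - B)
        + d * (k * A * n - B) * (x - n) * (k * n - 1)
        - K * (d * x - n ^ 2) * (d * k ^ 2 * A * n - B) = 0 → (k, n) ∈ G := by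
  set Y := y ^ 2 - y
  let D : F[X] := C Y * X + 1
  let p0 : F[X] := -(D * C (x * B ^ 2))
  let p1 : F[X] := D ^ 2 * X ^ 2 * C (2 * x * A * B) - D * X * (1 - D * X) * C (x * B)
  let p2 : F[X] := D * X * (1 - D * X) * (X * C (x * A) + C B) + C (B ^ 2)
    - D ^ 3 * X ^ 4 * C (x * A ^ 2)
  let p3 : F[X] := -(D * X ^ 2 * (1 - D * X) * C A) - D * X ^ 2 * C (2 * A * B)
  let p4 : F[X] := D ^ 2 * X ^ 4 * C (A ^ 2)
  let q0 : F[X] := D ^ 2 * (X * C y - 1) * C (x * B) + D * C (x * B * (1 - x + K))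
  let q1 : F[X] := D ^ 2 * (1 - X * C y) * X * C (x * A) + D ^ 2 * X ^ 2 * C (x * (x - K) * A)
    + D * C (2 * x * B - B) - D * X * C (x * (A + B))
  let q2 : F[X] := D * (1 - X * C y) * C B - D ^ 2 * X ^ 2 * C (2 * x * A) - D * C B
    + D * X ^ 2 * C (x * A) + D * X * C (A + B) - C (K * B)
  let q3 : F[X] := D ^ 2 * X ^ 2 * C A - D * (1 - X * C y) * X * C A
    + D * X ^ 2 * C ((K - 1) * A)
  let e : F[X] := D * X - (1 - X * C y) + X * C (K - 1)
  have hp0 : p0.natDegree ≤ 1 := by simp only [p0, D]; compute_degree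
  have hp1 : p1.natDegree ≤ 4 := by simp only [p1, D]; compute_degree
  have hp2 : p2.natDegree ≤ 7 := by simp only [p2, D]; compute_degree
  have hp3 : p3.natDegree ≤ 5 := by simp only [p3, D]; compute_degree
  have hp4 : p4.natDegree ≤ 6 := by simp only [p4, D]; compute_degree
  have hq0 : q0.natDegree ≤ 3 := by simp only [q0, D]; compute_degree
  have hq1 : q1.natDegree ≤ 4 := by simp only [q1, D]; compute_degree
  have hq2 : q2.natDegree ≤ 4 := by simp only [q2, D]; compute_degree
  have hq3 : q3.natDegree ≤ 4 := by simp only [q3, D]; compute_degree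
  have he : e.natDegree ≤ 2 := by simp only [e, D]; compute_degree
  have he0 : e ≠ 0 := fun h => by simpa [e, D] using congrArg (eval 0) h
  have cp2 : p2.coeff 7 = -(Y ^ 3 * (x * A ^ 2)) := by
    simp only [p2, D]; compute_degree!
  have cq0 : q0.coeff 3 = Y ^ 2 * y * (x * B) := by
    simp only [q0, D]; compute_degree!
  have cq3 : q3.coeff 4 = Y ^ 2 * A := by
    simp only [q3, D]; compute_degree!
  obtain ⟨hR, hdeg⟩ := det_sylvesterQuarticCubic_ne_zero hp0 hp1 hp2 hp3 hp4 hq0 hq1 hq2 hq3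
    (by rw [cp2]; simp [hx, hA, hY]) (by rw [cq0]; simp [hx, hy, hB, hY])
    (by rw [cq3]; simp [hA, hY])
  obtain ⟨G, hG, h⟩ := exists_finset_common_zeros (v := fun k => Y * k + 1 ≠ 0 ∧ k ≠ 0)
    hR hdeg he0 he (fun k hk => by simp [p0, D, hx, hB, hk.1])
    (fun k hk hq => by
      have : ((Y * k + 1) * k * A) * e.eval k = 0 := by
        rw [← hq]
        simp [q3, e, D]
        ring
      simpa [hk.1, hk.2, hA] using this)
  refine ⟨G, hG, fun k n d hd hd0 hk0 hP hQ => h k n ⟨?_, hk0⟩ ?_ ?_⟩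
  · rwa [add_comm, ← hd]
  · subst hd
    simp [p0, p1, p2, p3, p4, D]
    linear_combination hP
  · subst hd
    simp [q0, q1, q2, q3, D]
    linear_combination hQ

end Elimination

theorem S1Cond.ne_zero {p : ℕ} {S1 : Set (ZMod p)} (h : S1Cond p S1) {x : ZMod p}
    (hx : x ∈ S1) : x ≠ 0 := by
  rintro rfl
  simpa using (h _ hx).1.1

theorem S1Cond.add_ne_one {p : ℕ} (hp : p.Prime) {S1 : Set (ZMod p)} (h : S1Cond p S1)
    {x z : ZMod p} (hx : x ∈ S1) (hz : z ∈ S1) : x + z ≠ 1 := by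
  intro hxz
  have : Fact p.Prime := ⟨hp⟩
  have h1 := (h _ hx).1
  have h2 := (h _ hz).1
  have h3 := hp.two_le
  have h4 := congrArg ZMod.val hxz
  rw [ZMod.val_add_of_lt (by omega), ZMod.val_one] at h4
  omega

theorem S1Cond.ne_one {p : ℕ} (hp : p.Prime) {S1 : Set (ZMod p)} (h : S1Cond p S1)
    {x : ZMod p} (hx : x ∈ S1) : x ≠ 1 := by
  rintro rfl
  have : Fact p.Prime := ⟨hp⟩
  have := (h _ hx).1.1
  rw [ZMod.val_one] at this
  omega

theorem S1Cond.eq_of_mul_sub_one_eq {p : ℕ} (hp : p.Prime) {S1 : Set (ZMod p)}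
    (h : S1Cond p S1) {x z : ZMod p} (hx : x ∈ S1) (hz : z ∈ S1)
    (hxz : x * (x - 1) = z * (z - 1)) : x = z := by
  have : Fact p.Prime := ⟨hp⟩
  have : (x - z) * (x + z - 1) = 0 := by linear_combination hxz
  rcases mul_eq_zero.mp this with h' | h'
  · exact sub_eq_zero.mp h'
  · exact absurd (sub_eq_zero.mp h') (h.add_ne_one hp hx hz)

theorem hedge_eq_of_mem_Vpart_one {p : ℕ} {S1 : Set (ZMod p)} {x1 x2 x3 a : ZMod p}
    {v : ZMod p × ZMod p × ZMod p × ℕ} (hv : v ∈ Vpart p S1 1) (h : v ∈ hedge p x1 x2 x3 a) :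
    v = (x1, x2 * x3 + a, x2 ^ 2 * x3 + a, 1) := by
  have h1 := hv.2.2.2
  rcases h with rfl | rfl | rfl <;> simp_all

theorem hedge_eq_of_mem_Vpart_two {p : ℕ} {S1 : Set (ZMod p)} {x1 x2 x3 a : ZMod p}
    {v : ZMod p × ZMod p × ZMod p × ℕ} (hv : v ∈ Vpart p S1 2) (h : v ∈ hedge p x1 x2 x3 a) :
    v = (x2, x3 * x1 + a, x3 ^ 2 * x1 + a, 2) := by
  have h1 := hv.2.2.2
  rcases h with rfl | rfl | rfl <;> simp_all

theorem hedge_eq_of_mem_Vpart_three {p : ℕ} {S1 : Set (ZMod p)} {x1 x2 x3 a : ZMod p}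
    {v : ZMod p × ZMod p × ZMod p × ℕ} (hv : v ∈ Vpart p S1 3) (h : v ∈ hedge p x1 x2 x3 a) :
    v = (x3, x1 * x2 + a, x1 ^ 2 * x2 + a, 3) := by
  have h1 := hv.2.2.2
  rcases h with rfl | rfl | rfl <;> simp_all

theorem exists_path_parameters {p : ℕ} {S1 : Set (ZMod p)} {x s t y s' t' : ZMod p}
    {e1 e2 e3 : Set (ZMod p × ZMod p × ZMod p × ℕ)} {v2 v3 : ZMod p × ZMod p × ZMod p × ℕ}
    (hu : (x, s, t, 1) ∈ Vpart p S1 1) (hw : (y, s', t', 1) ∈ Vpart p S1 1)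
    (hv2 : v2 ∈ Vpart p S1 2) (hv3 : v3 ∈ Vpart p S1 3)
    (he1 : e1 ∈ Hedges p S1) (he2 : e2 ∈ Hedges p S1) (he3 : e3 ∈ Hedges p S1)
    (h1 : {(x, s, t, 1), v2} ⊆ e1) (h2 : {v2, v3} ⊆ e2) (h3 : {v3, (y, s', t', 1)} ⊆ e3) :
    ∃ b ∈ S1, ∃ c ∈ S1, ∃ d ∈ S1, ∃ f ∈ S1, ∃ g ∈ S1,
      e1 = hedge p x b c (s - b * c) ∧ e2 = hedge p d b f (s - b * c + c * x - f * d) ∧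
      e3 = hedge p y g f (s' - g * f) ∧
      c * (b * (b - 1)) = t - s ∧ x * (c * (c - 1)) = d * (f * (f - 1)) ∧
      b * (d * (d - 1)) = g * (y * (y - 1)) ∧ f * (g * (g - 1)) = t' - s' ∧
      d * b - b * c + c * x - f * d - y * g + g * f = s' - s := by
  obtain ⟨x1, b, c, a, -, hb, hc, -, rfl, -⟩ := he1
  obtain ⟨d, b', f, a', hd, -, hf, -, rfl, -⟩ := he2
  obtain ⟨y1, g, f', a'', -, hg, -, -, rfl, -⟩ := he3
  have k1 := hedge_eq_of_mem_Vpart_one hu (h1 (by simp))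
  have k2 := hedge_eq_of_mem_Vpart_two hv2 (h1 (by simp))
  have k3 := hedge_eq_of_mem_Vpart_two hv2 (h2 (by simp))
  have k4 := hedge_eq_of_mem_Vpart_three hv3 (h2 (by simp))
  have k5 := hedge_eq_of_mem_Vpart_three hv3 (h3 (by simp))
  have k6 := hedge_eq_of_mem_Vpart_one hw (h3 (by simp))
  rw [k2] at k3
  rw [k4] at k5
  simp only [Prod.mk.injEq, and_true] at k1 k3 k5 k6
  obtain ⟨rfl, rfl, rfl⟩ := k1
  obtain ⟨rfl, k31, k32⟩ := k3
  obtain ⟨rfl, k51, k52⟩ := k5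
  obtain ⟨rfl, rfl, rfl⟩ := k6
  refine ⟨b, hb, c, hc, d, hd, f, hf, g, hg, ?_, ?_, ?_, ?_, ?_, ?_, ?_, ?_⟩
  · congr 1; ring
  · congr 1; linear_combination -k31
  · congr 1; ring
  · ring
  · linear_combination k32 - k31
  · linear_combination k52 - k51
  · ring
  · linear_combination k31 + k51

/-- The edges of the path from `(x, s, _, 1)` to `(y, s', _, 1)` with elimination parameters `k` and
`n`, where `A` and `B` are the differences of the last two coordinates of the end vertices. -/
def pathOfParameters (p : ℕ) (x s y s' A B : ZMod p) (q : ZMod p × ZMod p) :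
    Set (ZMod p × ZMod p × ZMod p × ℕ) × Set (ZMod p × ZMod p × ZMod p × ℕ) ×
      Set (ZMod p × ZMod p × ZMod p × ℕ) :=
  let k := q.1
  let n := q.2
  let d := 1 + (y ^ 2 - y) * k
  let c := d * (x - n) * (d * x - n ^ 2)⁻¹
  let f := n * c * d⁻¹
  let b := (k * A * n - B) * (d * k ^ 2 * A * n - B)⁻¹
  let g := d * k * b
  (hedge p x b c (s - b * c), hedge p d b f (s - b * c + c * x - f * d), hedge p y g f (s' - g * f))

theorem stmt_17 :
    ∃ p0 : ℕ, ∀ p : ℕ, p.Prime → p0 ≤ p →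
      ∀ S1 : Set (ZMod p), S1Cond p S1 →
        ∀ u ∈ Vpart p S1 1, ∀ w ∈ Vpart p S1 1,
          {t : Set (ZMod p × ZMod p × ZMod p × ℕ) ×
               Set (ZMod p × ZMod p × ZMod p × ℕ) ×
               Set (ZMod p × ZMod p × ZMod p × ℕ) |
            t.1 ∈ Hedges p S1 ∧ t.2.1 ∈ Hedges p S1 ∧ t.2.2 ∈ Hedges p S1 ∧
            t.1 ≠ t.2.1 ∧ t.1 ≠ t.2.2 ∧ t.2.1 ≠ t.2.2 ∧
            ∃ v2 ∈ Vpart p S1 2, ∃ v3 ∈ Vpart p S1 3,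
              [u, v2, v3, w].Pairwise (· ≠ ·) ∧
              {u, v2} ⊆ t.1 ∧ {v2, v3} ⊆ t.2.1 ∧ {v3, w} ⊆ t.2.2}.encard ≤ 108 := by
  refine ⟨0, fun p hp _ S1 hS => ?_⟩
  have : Fact p.Prime := ⟨hp⟩
  rintro ⟨x, s, t, i⟩ hu ⟨y, s', t', i'⟩ hw
  obtain rfl : i = 1 := hu.2.2.2
  obtain rfl : i' = 1 := hw.2.2.2
  have hxS : x ∈ S1 := hu.1
  have hyS : y ∈ S1 := hw.1
  have hY : y ^ 2 - y ≠ 0 := by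
    have := mul_ne_zero (hS.ne_zero hyS) (sub_ne_zero.mpr (hS.ne_one hp hyS))
    rwa [mul_sub, mul_one, ← sq] at this
  set T := {t : Set (ZMod p × ZMod p × ZMod p × ℕ) × Set (ZMod p × ZMod p × ZMod p × ℕ) ×
    Set (ZMod p × ZMod p × ZMod p × ℕ) | _}
  rcases T.eq_empty_or_nonempty with hE | ⟨⟨E1, E2, E3⟩, hne⟩
  · simp [hE]
  have hAB : t - s ≠ 0 ∧ t' - s' ≠ 0 := by
    obtain ⟨he1, he2, he3, -, -, -, v2, hv2, v3, hv3, -, h1, h2, h3⟩ := hne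
    obtain ⟨b, hb, c, hc, d, hd, f, hf, g, hg, -, -, -, i1, -, -, i4, -⟩ :=
      exists_path_parameters hu hw hv2 hv3 he1 he2 he3 h1 h2 h3
    rw [← i1, ← i4]
    simp [hS.ne_zero, hb, hc, hf, hg, sub_eq_zero, hS.ne_one hp]
  obtain ⟨G, hG, hGmem⟩ := exists_finset_path_parameters x y (t - s) (t' - s') (s' - s)
    (hS.ne_zero hxS) (hS.ne_zero hyS) hY hAB.1 hAB.2
  have hsub : T ⊆ pathOfParameters p x s y s' (t - s) (t' - s') '' (G : Set (ZMod p × ZMod p)) := by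
    rintro ⟨e1, e2, e3⟩ ⟨he1, he2, he3, h12, -, h23, v2, hv2, v3, hv3, -, h1, h2, h3⟩
    obtain ⟨b, hb, c, hc, d, hd, f, hf, g, hg, j1, j2, j3, i1, i2, i3, i4, i5⟩ :=
      exists_path_parameters hu hw hv2 hv3 he1 he2 he3 h1 h2 h3
    dsimp only at j1 j2 j3 h12 h23
    have hd0 := hS.ne_zero hd
    have hd1 := sub_ne_zero.mpr (hS.ne_one hp hd)
    have hdx : d ≠ x := by
      rintro rfl
      have hcf := hS.eq_of_mul_sub_one_eq hp hc hf (mul_left_cancel₀ hd0 i2)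
      subst hcf
      apply h12
      rw [j1, j2, add_sub_cancel_right]
    have hdy : d ≠ y := by
      rintro rfl
      have hbg := mul_right_cancel₀ (mul_ne_zero hd0 hd1) i3
      subst hbg
      apply h23
      rw [j2, j3]
      congr 1
      linear_combination i5
    obtain ⟨k, hk⟩ : ∃ k, d = 1 + (y ^ 2 - y) * k :=
      ⟨(d - 1) / (y ^ 2 - y), by rw [mul_div_cancel₀ _ hY]; ring⟩
    have hk0 : k ≠ 0 := by
      rintro rfl
      apply hd1
      linear_combination hk
    have hk1 : d * k ≠ 1 := fun h => hdy <| hS.eq_of_mul_sub_one_eq hp hd hyS <| by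
      linear_combination d * hk + (y ^ 2 - y) * h
    have hn : d * f / c * c = d * f := div_mul_cancel₀ _ (hS.ne_zero hc)
    have hg' : g = d * k * b := by
      apply mul_left_cancel₀ hY
      linear_combination b * d * hk - i3
    obtain ⟨D1, D2, hc', hb', hP, hQ⟩ := path_elimination (hS.ne_zero hxS) hAB.1 hAB.2
      (hS.ne_zero hc) hd0 hn hk1 hdx i1 i2 hg' i4 i5
    refine ⟨(k, d * f / c), hGmem _ _ _ hk hd0 hk0 hP hQ, ?_⟩
    have hc'' := (eq_mul_inv_iff_mul_eq₀ D1).mpr hc'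
    have hb'' := (eq_mul_inv_iff_mul_eq₀ D2).mpr hb'
    have hf'' : f = d * f / c * c * d⁻¹ := by
      rw [hn, mul_comm d, mul_inv_cancel_right₀ hd0]
    simp only [pathOfParameters]
    rw [← hk, ← hc'', ← hb'', ← hf'', ← hg', j1, j2, j3]
  calc T.encard ≤ _ := Set.encard_le_encard hsub
    _ ≤ (G : Set (ZMod p × ZMod p)).encard := Set.encard_image_le _ _
    _ ≤ 108 := by
      rw [Set.encard_coe_eq_coe_finsetCard]
      exact_mod_cast hG
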